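/- arXiv:0809.0948 — 2 statements merged into one kernel-verified Lean document; each statement's English description precedes it below -/
import Mathlib

section
/- Let G be a Garside group of finite type and x ∈ G. Then for any z ∈ SSS(x) one has 𝔭↰(𝔰(z)) ≽ 𝔭(z) and 𝔭↰(z) ⪯ 𝔭(𝔰↰(z)). -/
/-- A Garside structure of finite type on a group `G`: a submonoid `P` of positive
elements with `P ∩ P⁻¹ = {1}`, such that the prefix order `a ⪯ b ↔ a⁻¹ * b ∈ P` is a
lattice order (with meet `wedge` and join `vee`), together with a Garside element `Δ ∈ P`
whose set of prefixes (the simple elements) is finite and generates `G`, satisfying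
`Δ⁻¹ P Δ = P`, and such that every nontrivial positive element has a finite norm. -/
structure GarsideStructure (G : Type*) [Group G] where
  P : Set G
  one_mem : (1 : G) ∈ P
  mul_mem : ∀ {a b : G}, a ∈ P → b ∈ P → a * b ∈ P
  eq_one_of_mem_of_inv_mem : ∀ a : G, a ∈ P → a⁻¹ ∈ P → a = 1
  wedge : G → G → G
  vee : G → G → G
  wedge_le_left : ∀ a b : G, (wedge a b)⁻¹ * a ∈ P
  wedge_le_right : ∀ a b : G, (wedge a b)⁻¹ * b ∈ P
  le_wedge : ∀ a b c : G, c⁻¹ * a ∈ P → c⁻¹ * b ∈ P → c⁻¹ * wedge a b ∈ P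
  le_vee_left : ∀ a b : G, a⁻¹ * vee a b ∈ P
  le_vee_right : ∀ a b : G, b⁻¹ * vee a b ∈ P
  vee_le : ∀ a b c : G, a⁻¹ * c ∈ P → b⁻¹ * c ∈ P → (vee a b)⁻¹ * c ∈ P
  Δ : G
  Δ_mem : Δ ∈ P
  simples_finite : {s : G | s ∈ P ∧ s⁻¹ * Δ ∈ P}.Finite
  simples_generate : Subgroup.closure {s : G | s ∈ P ∧ s⁻¹ * Δ ∈ P} = (⊤ : Subgroup G)
  conj_Delta_mem : ∀ a : G, a ∈ P → Δ⁻¹ * a * Δ ∈ P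
  mem_of_conj_Delta_mem : ∀ a : G, Δ⁻¹ * a * Δ ∈ P → a ∈ P
  norm_bounded : ∀ x : G, x ∈ P → x ≠ 1 →
    ∃ n : ℕ, ∀ L : List G, (∀ a ∈ L, a ∈ P ∧ a ≠ 1) → L.prod = x → L.length ≤ n

namespace GarsideStructure

variable {G : Type*} [Group G] (gs : GarsideStructure G)

/-- The prefix order: `a ⪯ b`. -/
def pre (a b : G) : Prop := a⁻¹ * b ∈ gs.P

/-- The suffix order: `a ≽ b` (i.e. `b` is a suffix of `a`). -/
def rdvd (a b : G) : Prop := a * b⁻¹ ∈ gs.P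

/-- Greatest common divisor with respect to the suffix order `≽` : `a ∧↰ b`. -/
def rwedge (a b : G) : G := (gs.vee a⁻¹ b⁻¹)⁻¹

/-- Least common multiple with respect to the suffix order `≽` : `a ∨↰ b`. -/
def rvee (a b : G) : G := (gs.wedge a⁻¹ b⁻¹)⁻¹

/-- Simple elements: positive prefixes of `Δ`. -/
def simple (s : G) : Prop := s ∈ gs.P ∧ s⁻¹ * gs.Δ ∈ gs.P

/-- Atoms: nontrivial positive elements which cannot be decomposed in `P`. -/
def atom (a : G) : Prop := a ∈ gs.P ∧ a ≠ 1 ∧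
  ∀ b c : G, b ∈ gs.P → c ∈ gs.P → a = b * c → b = 1 ∨ c = 1

/-- `inf x` : the maximal integer `p` with `Δ^p ⪯ x`. -/
noncomputable def ginf (x : G) : ℤ := sSup {p : ℤ | gs.pre (gs.Δ ^ p) x}

/-- `sup x` : the minimal integer `p` with `x ⪯ Δ^p`. -/
noncomputable def gsup (x : G) : ℤ := sInf {p : ℤ | gs.pre x (gs.Δ ^ p)}

/-- Canonical length `ℓ(x) = sup(x) - inf(x)`. -/
noncomputable def glen (x : G) : ℤ := gs.gsup x - gs.ginf x

/-- `‖x‖` : the maximal number of factors in a decomposition of `x` as a product of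
nontrivial positive elements. -/
noncomputable def gnorm (x : G) : ℕ :=
  sSup {k : ℕ | ∃ L : List G, (∀ a ∈ L, a ∈ gs.P ∧ a ≠ 1) ∧ L.prod = x ∧ L.length = k}

/-- The summit infimum `inf_s(x)` : the maximum of `inf` over the conjugacy class of `x`. -/
noncomputable def ginfs (x : G) : ℤ :=
  sSup {p : ℤ | ∃ y : G, (∃ α : G, α⁻¹ * x * α = y) ∧ p = gs.ginf y}

/-- The summit supremum `sup_s(x)` : the minimum of `sup` over the conjugacy class of `x`. -/
noncomputable def gsups (x : G) : ℤ :=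
  sInf {p : ℤ | ∃ y : G, (∃ α : G, α⁻¹ * x * α = y) ∧ p = gs.gsup y}

/-- The preferred prefix `𝔭(x) = (xΔ^{-inf x}) ∧ (x⁻¹Δ^{sup x}) ∧ Δ`. -/
noncomputable def pp (x : G) : G :=
  gs.wedge (gs.wedge (x * gs.Δ ^ (-gs.ginf x)) (x⁻¹ * gs.Δ ^ gs.gsup x)) gs.Δ

/-- Cyclic (left) sliding `𝔰(x) = 𝔭(x)⁻¹ x 𝔭(x)`. -/
noncomputable def sl (x : G) : G := (gs.pp x)⁻¹ * x * gs.pp x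

/-- The preferred suffix `𝔭↰(x) = (Δ^{-inf x}x) ∧↰ (Δ^{sup x}x⁻¹) ∧↰ Δ`. -/
noncomputable def ps (x : G) : G :=
  gs.rwedge (gs.rwedge (gs.Δ ^ (-gs.ginf x) * x) (gs.Δ ^ gs.gsup x * x⁻¹)) gs.Δ

/-- Cyclic right sliding `𝔰↰(x) = 𝔭↰(x) x 𝔭↰(x)⁻¹`. -/
noncomputable def rsl (x : G) : G := gs.ps x * x * (gs.ps x)⁻¹

/-- The super summit set `SSS(x)` : conjugates of `x` with maximal infimum and minimal
supremum among all conjugates of `x`. -/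
def SSS (x : G) : Set G :=
  {y | (∃ α : G, α⁻¹ * x * α = y) ∧
    ∀ z : G, (∃ α : G, α⁻¹ * x * α = z) → gs.ginf z ≤ gs.ginf y ∧ gs.gsup y ≤ gs.gsup z}

/-- The set of sliding circuits `SC(x)` : conjugates `y` of `x` with `𝔰^m(y) = y` for
some `m ≥ 1`. -/
noncomputable def SC (x : G) : Set G :=
  {y | (∃ α : G, α⁻¹ * x * α = y) ∧ ∃ m : ℕ, 1 ≤ m ∧ (gs.sl)^[m] y = y}

/-- The transport `α^{(1)} = 𝔭(x)⁻¹ α 𝔭(x^α)` of `α` at `x`. -/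
noncomputable def transport (x α : G) : G := (gs.pp x)⁻¹ * α * gs.pp (α⁻¹ * x * α)

/-- Iterated transport `α^{(i)}` of `α` at `x`: `α^{(0)} = α` and `α^{(i+1)}` is the
transport of `α^{(i)}` at `𝔰^i(x)`. -/
noncomputable def transportIter (x α : G) : ℕ → G
  | 0 => α
  | i + 1 => gs.transport ((gs.sl)^[i] x) (transportIter x α i)

/-- `c` is the `⪯`-minimal element `c_s(y)` satisfying `s ⪯ c` and `y^c ∈ SC(x)`. -/
def IsMinSCConj (x y s c : G) : Prop :=
  gs.pre s c ∧ (c⁻¹ * y * c) ∈ gs.SC x ∧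
    ∀ d : G, gs.pre s d → (d⁻¹ * y * d) ∈ gs.SC x → gs.pre c d

/-- `s` is an indecomposable conjugator starting at `u`: `u^s ∈ SC(x)`, `s ≠ 1` and there
is no `t` with `1 ≺ t ≺ s` and `u^t ∈ SC(x)`. -/
def IsIndecomposableConjugator (x u s : G) : Prop :=
  (s⁻¹ * u * s) ∈ gs.SC x ∧ s ≠ 1 ∧
    ¬ ∃ t : G, (gs.pre 1 t ∧ t ≠ 1) ∧ (gs.pre t s ∧ t ≠ s) ∧ (t⁻¹ * u * t) ∈ gs.SC x

/-- `u` is the pullback of `s` at `y = 𝔰(z)` : the `⪯`-minimal positive element with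
`z^u ∈ SSS(x)` and `s ⪯ u^{(1)}` (transport at `z`). -/
def IsPullback (x z s u : G) : Prop :=
  u ∈ gs.P ∧ (u⁻¹ * z * u) ∈ gs.SSS x ∧ gs.pre s (gs.transport z u) ∧
    ∀ u' : G, u' ∈ gs.P → (u'⁻¹ * z * u') ∈ gs.SSS x → gs.pre s (gs.transport z u') →
      gs.pre u u'

/-- The pullback `s_{(1)}` of `s` at `y = 𝔰(z)`. -/
noncomputable def pullbackOne (x z s : G) : G :=
  @Classical.epsilon G ⟨1⟩ (fun u => gs.IsPullback x z s u)

/-- The `k`-fold pullback `s_{(k)}` of `s` at `y = 𝔰^k(z)` (an element at `z`):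
`s_{(0)} = s` and `s_{(k+1)}` is the pullback at `𝔰(z)` (relative to `z`) of the `k`-fold
pullback of `s` at `𝔰^k(𝔰(z)) = y`. -/
noncomputable def pullbackIter (x : G) : G → ℕ → G → G
  | _, 0, s => s
  | z, k + 1, s => gs.pullbackOne x z (pullbackIter x (gs.sl z) k s)

end GarsideStructure

open GarsideStructure

variable {G : Type*} [Group G]

namespace GarsideStructure

variable (gs : GarsideStructure G)

lemma Delta_zpow_conj_mem {a : G} (n : ℤ) (ha : a ∈ gs.P) :
    gs.Δ ^ (-n) * a * gs.Δ ^ n ∈ gs.P := by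
  induction n using Int.induction_on with
  | zero => simpa using ha
  | succ n ih =>
    convert gs.conj_Delta_mem _ ih using 1
    rw [neg_add, add_comm (-(n : ℤ)) (-1), zpow_add, zpow_add_one, zpow_neg_one]
    group
  | pred n ih =>
    apply gs.mem_of_conj_Delta_mem
    convert ih using 1
    group

lemma mem_of_Delta_zpow_conj_eq {a b : G} (n : ℤ) (ha : a ∈ gs.P)
    (h : gs.Δ ^ (-n) * a * gs.Δ ^ n = b) : b ∈ gs.P :=
  h ▸ gs.Delta_zpow_conj_mem n ha

lemma exists_Delta_zpow_bounds (x : G) :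
    (∃ p : ℤ, gs.pre (gs.Δ ^ p) x) ∧ ∃ q : ℤ, gs.pre x (gs.Δ ^ q) := by
  have hx : x ∈ Subgroup.closure {s : G | s ∈ gs.P ∧ s⁻¹ * gs.Δ ∈ gs.P} := by
    simp [gs.simples_generate]
  induction hx using Subgroup.closure_induction with
  | mem s hs => exact ⟨⟨0, by simpa [pre] using hs.1⟩, ⟨1, by simpa [pre] using hs.2⟩⟩
  | one => exact ⟨⟨0, by simpa [pre] using gs.one_mem⟩, ⟨0, by simpa [pre] using gs.one_mem⟩⟩
  | mul x y _ _ hx hy =>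
    obtain ⟨⟨p, hp⟩, q, hq⟩ := hx
    obtain ⟨⟨p', hp'⟩, q', hq'⟩ := hy
    refine ⟨⟨p + p', ?_⟩, ⟨q' + q, ?_⟩⟩
    · have h := gs.mul_mem (gs.Delta_zpow_conj_mem p' hp) hp'
      unfold pre at *
      convert h using 1
      group
    · have h := gs.mul_mem hq' (gs.Delta_zpow_conj_mem q' hq)
      unfold pre at *
      convert h using 1
      group
  | inv x _ hx =>
    obtain ⟨⟨p, hp⟩, q, hq⟩ := hx
    refine ⟨⟨-q, ?_⟩, ⟨-p, ?_⟩⟩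
    · exact gs.mem_of_Delta_zpow_conj_eq (-q) hq (by group)
    · exact gs.mem_of_Delta_zpow_conj_eq (-p) hp (by group)

lemma subsingleton_of_Delta_eq_one (h : gs.Δ = 1) : Subsingleton G := by
  have pos (x : G) : x ∈ gs.P := by
    obtain ⟨p, hp⟩ := (gs.exists_Delta_zpow_bounds x).1
    simpa [pre, h] using hp
  have eq_one (x : G) : x = 1 := gs.eq_one_of_mem_of_inv_mem x (pos x) (pos x⁻¹)
  exact ⟨fun a b => (eq_one a).trans (eq_one b).symm⟩

lemma Delta_pow_mem (n : ℕ) : gs.Δ ^ n ∈ gs.P := by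
  induction n with
  | zero => simpa using gs.one_mem
  | succ n ih => rw [pow_succ]; exact gs.mul_mem ih gs.Δ_mem

lemma le_of_Delta_zpow_bounds [Nontrivial G] {x : G} {p q : ℤ}
    (hp : gs.pre (gs.Δ ^ p) x) (hq : gs.pre x (gs.Δ ^ q)) : p ≤ q := by
  by_contra! hlt
  obtain ⟨n, hn⟩ := Int.eq_ofNat_of_zero_le (show 0 ≤ p - q - 1 by lia)
  obtain rfl : p = q + 1 + n := by lia
  have hinv : gs.Δ⁻¹ ∈ gs.P := by
    convert gs.mul_mem (gs.Delta_pow_mem n) (gs.mul_mem hp hq) using 1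
    rw [← zpow_natCast]
    group
  exact not_subsingleton G
    (gs.subsingleton_of_Delta_eq_one (gs.eq_one_of_mem_of_inv_mem _ gs.Δ_mem hinv))

lemma bddAbove_inf_set [Nontrivial G] (x : G) : BddAbove {p : ℤ | gs.pre (gs.Δ ^ p) x} := by
  obtain ⟨q, hq⟩ := (gs.exists_Delta_zpow_bounds x).2
  exact ⟨q, fun p hp => gs.le_of_Delta_zpow_bounds hp hq⟩

lemma bddBelow_sup_set [Nontrivial G] (x : G) : BddBelow {q : ℤ | gs.pre x (gs.Δ ^ q)} := by
  obtain ⟨p, hp⟩ := (gs.exists_Delta_zpow_bounds x).1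
  exact ⟨p, fun q hq => gs.le_of_Delta_zpow_bounds hp hq⟩

lemma Delta_zpow_ginf_pre [Nontrivial G] (x : G) : gs.pre (gs.Δ ^ gs.ginf x) x :=
  Int.csSup_mem (gs.exists_Delta_zpow_bounds x).1 (gs.bddAbove_inf_set x)

lemma pre_Delta_zpow_gsup [Nontrivial G] (x : G) : gs.pre x (gs.Δ ^ gs.gsup x) :=
  Int.csInf_mem (gs.exists_Delta_zpow_bounds x).2 (gs.bddBelow_sup_set x)

lemma ginf_gsup_eq_of_mem_SSS [Nontrivial G] {x z y : G} (hz : z ∈ gs.SSS x)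
    (hconj : ∃ α : G, α⁻¹ * z * α = y) (hinf : gs.pre (gs.Δ ^ gs.ginf z) y)
    (hsup : gs.pre y (gs.Δ ^ gs.gsup z)) :
    gs.ginf y = gs.ginf z ∧ gs.gsup y = gs.gsup z := by
  obtain ⟨⟨β, rfl⟩, hmax⟩ := hz
  obtain ⟨α, rfl⟩ := hconj
  obtain ⟨h₁, h₂⟩ := hmax (α⁻¹ * (β⁻¹ * x * β) * α) ⟨β * α, by group⟩
  exact ⟨h₁.antisymm (le_csSup (gs.bddAbove_inf_set _) hinf),
    (csInf_le (gs.bddBelow_sup_set _) hsup).antisymm h₂⟩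

lemma rdvd_rwedge_left (a b : G) : gs.rdvd a (gs.rwedge a b) := by
  simpa [rdvd, rwedge] using gs.le_vee_left a⁻¹ b⁻¹

lemma rdvd_rwedge_right (a b : G) : gs.rdvd b (gs.rwedge a b) := by
  simpa [rdvd, rwedge] using gs.le_vee_right a⁻¹ b⁻¹

lemma rwedge_rdvd {a b c : G} (ha : gs.rdvd a c) (hb : gs.rdvd b c) :
    gs.rdvd (gs.rwedge a b) c :=
  gs.vee_le a⁻¹ b⁻¹ c⁻¹ (by simpa [rdvd] using ha) (by simpa [rdvd] using hb)

lemma pre_trans {a b c : G} (hab : gs.pre a b) (hbc : gs.pre b c) : gs.pre a c := by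
  simpa [pre, mul_assoc] using gs.mul_mem hab hbc

lemma rdvd_trans {a b c : G} (hab : gs.rdvd a b) (hbc : gs.rdvd b c) : gs.rdvd a c := by
  simpa [rdvd, mul_assoc] using gs.mul_mem hab hbc

lemma pp_pre_left (z : G) : gs.pre (gs.pp z) (z * gs.Δ ^ (-gs.ginf z)) :=
  gs.pre_trans (gs.wedge_le_left _ _) (gs.wedge_le_left _ _)

lemma pp_pre_right (z : G) : gs.pre (gs.pp z) (z⁻¹ * gs.Δ ^ gs.gsup z) :=
  gs.pre_trans (gs.wedge_le_left _ _) (gs.wedge_le_right _ _)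

lemma pp_pre_Delta (z : G) : gs.pre (gs.pp z) gs.Δ :=
  gs.wedge_le_right _ _

lemma rdvd_ps_left (z : G) : gs.rdvd (gs.Δ ^ (-gs.ginf z) * z) (gs.ps z) :=
  gs.rdvd_trans (gs.rdvd_rwedge_left _ _) (gs.rdvd_rwedge_left _ _)

lemma rdvd_ps_right (z : G) : gs.rdvd (gs.Δ ^ gs.gsup z * z⁻¹) (gs.ps z) :=
  gs.rdvd_trans (gs.rdvd_rwedge_right _ _) (gs.rdvd_rwedge_left _ _)

lemma Delta_rdvd_ps (z : G) : gs.rdvd gs.Δ (gs.ps z) :=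
  gs.rdvd_rwedge_right _ _

lemma pp_mem [Nontrivial G] (z : G) : gs.pp z ∈ gs.P := by
  have h₁ : (1 : G)⁻¹ * (z * gs.Δ ^ (-gs.ginf z)) ∈ gs.P :=
    gs.mem_of_Delta_zpow_conj_eq (-gs.ginf z) (gs.Delta_zpow_ginf_pre z) (by group)
  have h₂ : (1 : G)⁻¹ * (z⁻¹ * gs.Δ ^ gs.gsup z) ∈ gs.P := by
    simpa [pre] using gs.pre_Delta_zpow_gsup z
  simpa [pp] using gs.le_wedge _ _ 1 (gs.le_wedge _ _ 1 h₁ h₂) (by simpa using gs.Δ_mem)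

lemma ps_mem [Nontrivial G] (z : G) : gs.ps z ∈ gs.P := by
  have h₁ : gs.rdvd (gs.Δ ^ (-gs.ginf z) * z) 1 := by
    simpa [rdvd, pre] using gs.Delta_zpow_ginf_pre z
  have h₂ : gs.rdvd (gs.Δ ^ gs.gsup z * z⁻¹) 1 :=
    gs.mem_of_Delta_zpow_conj_eq (-gs.gsup z) (gs.pre_Delta_zpow_gsup z) (by group)
  have h := gs.rwedge_rdvd (gs.rwedge_rdvd h₁ h₂)
    (show gs.rdvd gs.Δ 1 by simpa [rdvd] using gs.Δ_mem)
  simpa [rdvd, ps] using h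

lemma ginf_gsup_sl [Nontrivial G] {x z : G} (hz : z ∈ gs.SSS x) :
    gs.ginf (gs.sl z) = gs.ginf z ∧ gs.gsup (gs.sl z) = gs.gsup z := by
  refine gs.ginf_gsup_eq_of_mem_SSS hz ⟨gs.pp z, rfl⟩ ?_ ?_
  · have h := gs.mul_mem (gs.Delta_zpow_conj_mem (gs.ginf z) (gs.pp_pre_left z)) (gs.pp_mem z)
    unfold pre sl
    convert h using 1
    group
  · have h := gs.mul_mem (gs.pp_pre_right z) (gs.Delta_zpow_conj_mem (gs.gsup z) (gs.pp_mem z))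
    unfold pre sl
    convert h using 1
    group

lemma ginf_gsup_rsl [Nontrivial G] {x z : G} (hz : z ∈ gs.SSS x) :
    gs.ginf (gs.rsl z) = gs.ginf z ∧ gs.gsup (gs.rsl z) = gs.gsup z := by
  refine gs.ginf_gsup_eq_of_mem_SSS hz ⟨(gs.ps z)⁻¹, by simp [rsl]⟩ ?_ ?_
  · have h := gs.mul_mem (gs.Delta_zpow_conj_mem (gs.ginf z) (gs.ps_mem z)) (gs.rdvd_ps_left z)
    unfold pre rsl
    convert h using 1
    group
  · have h := gs.mul_mem (gs.ps_mem z) (gs.Delta_zpow_conj_mem (gs.gsup z) (gs.rdvd_ps_right z))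
    unfold pre rsl
    convert h using 1
    group

lemma ps_sl_rdvd_pp [Nontrivial G] {x z : G} (hz : z ∈ gs.SSS x) :
    gs.rdvd (gs.ps (gs.sl z)) (gs.pp z) := by
  obtain ⟨hinf, hsup⟩ := gs.ginf_gsup_sl hz
  rw [ps, hinf, hsup]
  refine gs.rwedge_rdvd (gs.rwedge_rdvd ?_ ?_) ?_
  · exact gs.mem_of_Delta_zpow_conj_eq (gs.ginf z) (gs.pp_pre_left z) (by unfold sl; group)
  · exact gs.mem_of_Delta_zpow_conj_eq (-gs.gsup z) (gs.pp_pre_right z) (by unfold sl; group)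
  · exact gs.mem_of_Delta_zpow_conj_eq (-1) (gs.pp_pre_Delta z) (by group)

lemma ps_pre_pp_rsl [Nontrivial G] {x z : G} (hz : z ∈ gs.SSS x) :
    gs.pre (gs.ps z) (gs.pp (gs.rsl z)) := by
  obtain ⟨hinf, hsup⟩ := gs.ginf_gsup_rsl hz
  rw [pp, hinf, hsup]
  refine gs.le_wedge _ _ _ (gs.le_wedge _ _ _ ?_ ?_) ?_
  · exact gs.mem_of_Delta_zpow_conj_eq (-gs.ginf z) (gs.rdvd_ps_left z) (by unfold rsl; group)
  · exact gs.mem_of_Delta_zpow_conj_eq (gs.gsup z) (gs.rdvd_ps_right z) (by unfold rsl; group)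
  · exact gs.mem_of_Delta_zpow_conj_eq 1 (gs.Delta_rdvd_ps z) (by group)

end GarsideStructure

/-- For a super summit element `z` one has `𝔭↰(𝔰(z)) ≽ 𝔭(z)` and `𝔭↰(z) ⪯ 𝔭(𝔰↰(z))`. -/
theorem preferred_prefix_suffix (gs : GarsideStructure G) (x z : G)
    (hz : z ∈ gs.SSS x) :
    gs.rdvd (gs.ps (gs.sl z)) (gs.pp z) ∧ gs.pre (gs.ps z) (gs.pp (gs.rsl z)) := by
  rcases subsingleton_or_nontrivial G with hG | hG
  · have pos (a : G) : a ∈ gs.P := Subsingleton.elim 1 a ▸ gs.one_mem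
    exact ⟨pos _, pos _⟩
  · exact ⟨gs.ps_sl_rdvd_pp hz, gs.ps_pre_pp_rsl hz⟩
end

section
/- Let G be a Garside group of finite type, x ∈ G, y ∈ SC(x) and s ∈ G, and write c_s = c_s(y). Let N be the smallest positive integer such that 𝔰^N(y) = y. If c_s ⪯ c_s^{(iN)} for some i > 0 (iterated transport at y), then c_s^{(iN)} = c_s. -/
open GarsideStructure

variable {G : Type*} [Group G]

namespace GarsideStructure

/-! ### The prefix order -/

theorem pre_refl (gs : GarsideStructure G) (a : G) : gs.pre a a := by
  simpa [pre] using gs.one_mem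

theorem pre_trans_s13 (gs : GarsideStructure G) {a b c : G} (h₁ : gs.pre a b) (h₂ : gs.pre b c) :
    gs.pre a c := by
  have h := gs.mul_mem h₁ h₂
  rwa [show a⁻¹ * b * (b⁻¹ * c) = a⁻¹ * c by group] at h

theorem pre_antisymm (gs : GarsideStructure G) {a b : G} (h₁ : gs.pre a b) (h₂ : gs.pre b a) :
    a = b := by
  have h := gs.eq_one_of_mem_of_inv_mem _ h₁ (by simpa [pre] using h₂)
  exact inv_mul_eq_one.mp h

theorem pre_mul_left_iff (gs : GarsideStructure G) (t a b : G) :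
    gs.pre (t * a) (t * b) ↔ gs.pre a b := by
  simp [pre, mul_assoc]

theorem pre_wedge_iff (gs : GarsideStructure G) (a b c : G) :
    gs.pre c (gs.wedge a b) ↔ gs.pre c a ∧ gs.pre c b :=
  ⟨fun h => ⟨gs.pre_trans_s13 h (gs.wedge_le_left a b), gs.pre_trans_s13 h (gs.wedge_le_right a b)⟩,
    fun h => gs.le_wedge a b c h.1 h.2⟩

theorem eq_of_forall_pre_iff (gs : GarsideStructure G) {a b : G}
    (h : ∀ c, gs.pre c a ↔ gs.pre c b) : a = b :=
  gs.pre_antisymm ((h a).1 (gs.pre_refl a)) ((h b).2 (gs.pre_refl b))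

theorem wedge_eq_left (gs : GarsideStructure G) {a b : G} (h : gs.pre a b) :
    gs.wedge a b = a :=
  gs.pre_antisymm (gs.wedge_le_left a b) (gs.le_wedge a b a (gs.pre_refl a) h)

theorem wedge_comm (gs : GarsideStructure G) (a b : G) : gs.wedge a b = gs.wedge b a :=
  gs.eq_of_forall_pre_iff fun c => by simp only [pre_wedge_iff, and_comm]

theorem wedge_mono (gs : GarsideStructure G) {a b a' b' : G} (h₁ : gs.pre a a')
    (h₂ : gs.pre b b') : gs.pre (gs.wedge a b) (gs.wedge a' b') :=
  gs.le_wedge _ _ _ (gs.pre_trans_s13 (gs.wedge_le_left a b) h₁)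
    (gs.pre_trans_s13 (gs.wedge_le_right a b) h₂)

theorem mul_wedge (gs : GarsideStructure G) (t a b : G) :
    t * gs.wedge a b = gs.wedge (t * a) (t * b) :=
  gs.eq_of_forall_pre_iff fun c => by
    rw [← mul_inv_cancel_left t c]
    simp only [pre_mul_left_iff, pre_wedge_iff]

theorem conj_Delta_zpow_mem_iff (gs : GarsideStructure G) (k : ℤ) (a : G) :
    (gs.Δ ^ k)⁻¹ * a * gs.Δ ^ k ∈ gs.P ↔ a ∈ gs.P := by
  have key : ∀ b, gs.Δ⁻¹ * b * gs.Δ ∈ gs.P ↔ b ∈ gs.P := fun b =>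
    ⟨gs.mem_of_conj_Delta_mem b, gs.conj_Delta_mem b⟩
  induction k using Int.induction_on with
  | zero => simp
  | succ n ih =>
    refine Iff.trans ?_ ih
    rw [← key ((gs.Δ ^ (n : ℤ))⁻¹ * a * gs.Δ ^ (n : ℤ)), zpow_add_one]
    simp [mul_assoc]
  | pred n ih =>
    refine Iff.trans ?_ ih
    rw [← key ((gs.Δ ^ (-(n : ℤ) - 1))⁻¹ * a * gs.Δ ^ (-(n : ℤ) - 1)), zpow_sub_one]
    simp [mul_assoc]

theorem pre_mul_Delta_zpow_iff (gs : GarsideStructure G) (k : ℤ) (a b : G) :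
    gs.pre (a * gs.Δ ^ k) (b * gs.Δ ^ k) ↔ gs.pre a b := by
  rw [pre, pre, ← gs.conj_Delta_zpow_mem_iff k (a⁻¹ * b)]
  simp [mul_assoc]

theorem wedge_mul_Delta_zpow (gs : GarsideStructure G) (k : ℤ) (a b : G) :
    gs.wedge a b * gs.Δ ^ k = gs.wedge (a * gs.Δ ^ k) (b * gs.Δ ^ k) :=
  gs.eq_of_forall_pre_iff fun c => by
    rw [← inv_mul_cancel_right c (gs.Δ ^ k)]
    simp only [pre_mul_Delta_zpow_iff, pre_wedge_iff]

theorem pre_mul_mul_Delta_zpow_iff (gs : GarsideStructure G) (t : G) (k : ℤ) (a b : G) :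
    gs.pre (t * a * gs.Δ ^ k) (t * b * gs.Δ ^ k) ↔ gs.pre a b := by
  rw [pre_mul_Delta_zpow_iff, pre_mul_left_iff]

theorem one_pre_Delta_zpow (gs : GarsideStructure G) {k : ℤ} (hk : 0 ≤ k) :
    gs.pre 1 (gs.Δ ^ k) := by
  obtain ⟨n, rfl⟩ := Int.eq_ofNat_of_zero_le hk
  induction n with
  | zero => simpa using gs.pre_refl 1
  | succ n ih =>
    have h := gs.mul_mem (ih (by positivity)) gs.Δ_mem
    simpa [pre, zpow_add_one] using h

theorem pre_mul_Delta_zpow (gs : GarsideStructure G) (a : G) {k l : ℤ} (h : k ≤ l) :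
    gs.pre (a * gs.Δ ^ k) (a * gs.Δ ^ l) := by
  have := gs.one_pre_Delta_zpow (sub_nonneg.2 h)
  rw [← gs.pre_mul_left_iff (a * gs.Δ ^ k), mul_assoc a, mul_assoc a, ← zpow_add] at this
  simpa using this

theorem Delta_zpow_pre (gs : GarsideStructure G) {k l : ℤ} (h : k ≤ l) :
    gs.pre (gs.Δ ^ k) (gs.Δ ^ l) := by
  simpa using gs.pre_mul_Delta_zpow 1 h

theorem Delta_zpow_pre_inv_iff (gs : GarsideStructure G) (k : ℤ) (a : G) :
    gs.pre (gs.Δ ^ k) a⁻¹ ↔ gs.pre a (gs.Δ ^ (-k)) := by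
  rw [← gs.pre_mul_left_iff a, ← gs.pre_mul_Delta_zpow_iff (-k) (a * gs.Δ ^ k)]
  simp

theorem exists_pre_Delta_zpow (gs : GarsideStructure G) (g : G) :
    ∃ q : ℤ, gs.pre g (gs.Δ ^ q) ∧ gs.pre (gs.Δ ^ (-q)) g := by
  have hg : g ∈ Subgroup.closure {s : G | s ∈ gs.P ∧ s⁻¹ * gs.Δ ∈ gs.P} := by
    rw [gs.simples_generate]; trivial
  induction hg using Subgroup.closure_induction with
  | mem s hs =>
    refine ⟨1, by simpa [pre] using hs.2, ?_⟩
    have : gs.pre (gs.Δ ^ (-1 : ℤ)) (gs.Δ ^ (0 : ℤ)) := gs.Delta_zpow_pre (by norm_num)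
    rw [zpow_zero] at this
    exact gs.pre_trans_s13 this (by simpa [pre] using hs.1)
  | one => exact ⟨0, by simpa using gs.pre_refl 1, by simpa using gs.pre_refl 1⟩
  | mul a b _ _ iha ihb =>
    obtain ⟨p, hp, hp'⟩ := iha
    obtain ⟨q, hq, hq'⟩ := ihb
    refine ⟨p + q, ?_, ?_⟩
    · rw [zpow_add]
      exact gs.pre_trans_s13 ((gs.pre_mul_left_iff a _ _).2 hq)
        ((gs.pre_mul_Delta_zpow_iff q _ _).2 hp)
    · rw [neg_add, zpow_add]
      exact gs.pre_trans_s13 ((gs.pre_mul_Delta_zpow_iff (-q) _ _).2 hp')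
        ((gs.pre_mul_left_iff a _ _).2 hq')
  | inv a _ ih =>
    obtain ⟨q, hq, hq'⟩ := ih
    refine ⟨q, ?_, ?_⟩
    · rw [← neg_neg q, ← Delta_zpow_pre_inv_iff, inv_inv]; exact hq'
    · rw [Delta_zpow_pre_inv_iff, neg_neg]; exact hq

/-! ### Chain conditions -/

theorem eq_one_of_mul_eq_one (gs : GarsideStructure G) {a b : G} (ha : a ∈ gs.P)
    (hb : b ∈ gs.P) (h : a * b = 1) : a = 1 ∧ b = 1 := by
  have ha1 : a = 1 :=
    gs.eq_one_of_mem_of_inv_mem a ha (by rwa [inv_eq_of_mul_eq_one_right h])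
  exact ⟨ha1, by simpa [ha1] using h⟩

theorem exists_lt_length (gs : GarsideStructure G) {x : G} (hx : x ∈ gs.P) :
    ∃ n : ℕ, ∀ L : List G, (∀ a ∈ L, a ∈ gs.P ∧ a ≠ 1) → ∀ r ∈ gs.P, ∀ t ∈ gs.P,
      r * L.prod * t = x → L.length ≤ n := by
  by_cases hx1 : x = 1
  · refine ⟨0, ?_⟩
    rintro (_ | ⟨a, L⟩) hL r hr t ht h
    · simp
    · exfalso
      have hLP : ∀ L : List G, (∀ a ∈ L, a ∈ gs.P ∧ a ≠ 1) → L.prod ∈ gs.P := by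
        intro L hL
        induction L with
        | nil => simpa using gs.one_mem
        | cons b L ih =>
          simp only [List.mem_cons, forall_eq_or_imp] at hL
          simpa using gs.mul_mem hL.1.1 (ih hL.2)
      simp only [List.mem_cons, forall_eq_or_imp] at hL
      have hP := gs.mul_mem (hLP L hL.2) ht
      have h1 := (gs.eq_one_of_mul_eq_one hr (gs.mul_mem hL.1.1 hP)
        (by rw [← hx1, ← h]; simp [mul_assoc])).2
      exact hL.1.2 (gs.eq_one_of_mul_eq_one hL.1.1 hP h1).1
  · obtain ⟨n, hn⟩ := gs.norm_bounded x hx hx1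
    refine ⟨n, fun L hL r hr t ht h => ?_⟩
    by_cases hr1 : r = 1 <;> by_cases ht1 : t = 1
    · exact hn L hL (by simpa [hr1, ht1] using h)
    · have := hn (L ++ [t]) (by
        intro a ha
        simp only [List.mem_append, List.mem_singleton] at ha
        rcases ha with ha | rfl
        exacts [hL a ha, ⟨ht, ht1⟩]) (by simpa [hr1] using h)
      simp at this; omega
    · have := hn (r :: L) (by
        intro a ha
        simp only [List.mem_cons] at ha
        rcases ha with rfl | ha
        exacts [⟨hr, hr1⟩, hL a ha]) (by simpa [ht1] using h)
      simp at this; omega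
    · have := hn (r :: (L ++ [t])) (by
        intro a ha
        simp only [List.mem_cons, List.mem_append, List.not_mem_nil, or_false] at ha
        rcases ha with rfl | ha | rfl
        exacts [⟨hr, hr1⟩, hL a ha, ⟨ht, ht1⟩]) (by simpa [mul_assoc] using h)
      simp at this; omega

theorem exists_eq_of_descending (gs : GarsideStructure G) (f : ℕ → G) (b : G)
    (hf : ∀ n, gs.pre (f (n + 1)) (f n)) (hb : ∀ n, gs.pre b (f n)) :
    ∃ m, f (m + 1) = f m := by
  by_contra! hne
  obtain ⟨n, hn⟩ := gs.exists_lt_length (hb 0)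
  have key : ∀ k, ∃ L : List G, (∀ a ∈ L, a ∈ gs.P ∧ a ≠ 1) ∧ L.length = k ∧
      L.prod = (f k)⁻¹ * f 0 := by
    intro k
    induction k with
    | zero => exact ⟨[], by simp⟩
    | succ k ih =>
      obtain ⟨L, hL, hlen, hprod⟩ := ih
      refine ⟨(f (k + 1))⁻¹ * f k :: L, ?_, by simp [hlen], by simp [hprod, mul_assoc]⟩
      simp only [List.mem_cons, forall_eq_or_imp]
      exact ⟨⟨hf k, fun h => hne k (inv_mul_eq_one.1 h)⟩, hL⟩
  obtain ⟨L, hL, hlen, hprod⟩ := key (n + 1)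
  have := hn L hL _ (hb (n + 1)) 1 gs.one_mem (by rw [hprod]; group)
  omega

theorem exists_eq_of_ascending (gs : GarsideStructure G) (f : ℕ → G) (b : G)
    (hf : ∀ n, gs.pre (f n) (f (n + 1))) (hb : ∀ n, gs.pre (f n) b) :
    ∃ m, f (m + 1) = f m := by
  by_contra! hne
  obtain ⟨n, hn⟩ := gs.exists_lt_length (hb 0)
  have key : ∀ k, ∃ L : List G, (∀ a ∈ L, a ∈ gs.P ∧ a ≠ 1) ∧ L.length = k ∧
      L.prod = (f 0)⁻¹ * f k := by
    intro k
    induction k with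
    | zero => exact ⟨[], by simp⟩
    | succ k ih =>
      obtain ⟨L, hL, hlen, hprod⟩ := ih
      refine ⟨L ++ [(f k)⁻¹ * f (k + 1)], ?_, by simp [hlen], by simp [hprod, mul_assoc]⟩
      intro a ha
      simp only [List.mem_append, List.mem_singleton] at ha
      rcases ha with ha | rfl
      exacts [hL a ha, ⟨hf k, fun h => hne k (inv_mul_eq_one.1 h).symm⟩]
  obtain ⟨L, hL, hlen, hprod⟩ := key (n + 1)
  have := hn L hL 1 gs.one_mem _ (hb (n + 1)) (by rw [hprod]; group)
  omega

/-! ### Infimum and supremum -/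

theorem eq_one_of_Delta_eq_one (gs : GarsideStructure G) (h : gs.Δ = 1) (g : G) : g = 1 := by
  obtain ⟨q, h₁, h₂⟩ := gs.exists_pre_Delta_zpow g
  simp only [h, one_zpow] at h₁ h₂
  exact gs.pre_antisymm h₁ h₂

theorem le_of_Delta_zpow_pre (gs : GarsideStructure G) (hΔ : gs.Δ ≠ 1) {k l : ℤ}
    (h : gs.pre (gs.Δ ^ k) (gs.Δ ^ l)) : k ≤ l := by
  by_contra! hlt
  have h1 : gs.pre (gs.Δ ^ (l + 1)) (gs.Δ ^ l) := gs.pre_trans_s13 (gs.Delta_zpow_pre hlt) h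
  have h2 := gs.pre_antisymm h1 (gs.Delta_zpow_pre (by omega))
  rw [zpow_add_one] at h2
  exact hΔ (by simpa using h2)

theorem Delta_zpow_pre_iff (gs : GarsideStructure G) (hΔ : gs.Δ ≠ 1) (x : G) (k : ℤ) :
    gs.pre (gs.Δ ^ k) x ↔ k ≤ gs.ginf x := by
  obtain ⟨q, h₁, h₂⟩ := gs.exists_pre_Delta_zpow x
  have hbdd : BddAbove {p : ℤ | gs.pre (gs.Δ ^ p) x} :=
    ⟨q, fun p hp => gs.le_of_Delta_zpow_pre hΔ (gs.pre_trans_s13 hp h₁)⟩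
  have hmem : gs.pre (gs.Δ ^ gs.ginf x) x := Int.csSup_mem ⟨-q, h₂⟩ hbdd
  exact ⟨fun h => le_csSup hbdd h, fun h => gs.pre_trans_s13 (gs.Delta_zpow_pre h) hmem⟩

theorem pre_Delta_zpow_iff (gs : GarsideStructure G) (hΔ : gs.Δ ≠ 1) (x : G) (k : ℤ) :
    gs.pre x (gs.Δ ^ k) ↔ gs.gsup x ≤ k := by
  obtain ⟨q, h₁, h₂⟩ := gs.exists_pre_Delta_zpow x
  have hbdd : BddBelow {p : ℤ | gs.pre x (gs.Δ ^ p)} :=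
    ⟨-q, fun p hp => gs.le_of_Delta_zpow_pre hΔ (gs.pre_trans_s13 h₂ hp)⟩
  have hmem : gs.pre x (gs.Δ ^ gs.gsup x) := Int.csInf_mem ⟨q, h₁⟩ hbdd
  exact ⟨fun h => csInf_le hbdd h, fun h => gs.pre_trans_s13 hmem (gs.Delta_zpow_pre h)⟩

theorem ginf_inv (gs : GarsideStructure G) (hΔ : gs.Δ ≠ 1) (x : G) :
    gs.ginf x⁻¹ = -gs.gsup x := by
  refine eq_of_forall_le_iff fun k => ?_
  rw [← gs.Delta_zpow_pre_iff hΔ, Delta_zpow_pre_inv_iff, gs.pre_Delta_zpow_iff hΔ]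
  omega

theorem gsup_inv (gs : GarsideStructure G) (hΔ : gs.Δ ≠ 1) (x : G) :
    gs.gsup x⁻¹ = -gs.ginf x := by
  rw [← neg_eq_iff_eq_neg, ← gs.ginf_inv hΔ, inv_inv]

theorem pp_inv (gs : GarsideStructure G) (hΔ : gs.Δ ≠ 1) (x : G) : gs.pp x⁻¹ = gs.pp x := by
  rw [pp, pp, gs.ginf_inv hΔ, gs.gsup_inv hΔ, inv_inv, neg_neg, gs.wedge_comm (x⁻¹ * _)]

theorem sl_inv (gs : GarsideStructure G) (hΔ : gs.Δ ≠ 1) (x : G) : gs.sl x⁻¹ = (gs.sl x)⁻¹ := by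
  simp [sl, gs.pp_inv hΔ, mul_assoc]

theorem iterate_sl_inv (gs : GarsideStructure G) (hΔ : gs.Δ ≠ 1) (x : G) (n : ℕ) :
    gs.sl^[n] x⁻¹ = (gs.sl^[n] x)⁻¹ := by
  induction n with
  | zero => rfl
  | succ n ih => rw [Function.iterate_succ_apply', Function.iterate_succ_apply', ih, gs.sl_inv hΔ]

/-! ### Cyclic sliding and conjugating elements -/

/-- `α ↦ (x α Δ^{-p}) ∧ (x⁻¹ α Δ^r) ∧ (α Δ)`: for `p = inf (x^α)` and `r = sup (x^α)`, this is
the product of `α` with the preferred prefix of `x^α`. -/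
def slideMap (gs : GarsideStructure G) (x : G) (p r : ℤ) (α : G) : G :=
  gs.wedge (gs.wedge (x * α * gs.Δ ^ (-p)) (x⁻¹ * α * gs.Δ ^ r)) (α * gs.Δ)

theorem mul_pp_conj (gs : GarsideStructure G) (x α : G) :
    α * gs.pp (α⁻¹ * x * α) =
      gs.slideMap x (gs.ginf (α⁻¹ * x * α)) (gs.gsup (α⁻¹ * x * α)) α := by
  simp [pp, slideMap, mul_wedge, mul_assoc]

theorem slideMap_mono (gs : GarsideStructure G) (x : G) (p r : ℤ) {α β : G}
    (h : gs.pre α β) : gs.pre (gs.slideMap x p r α) (gs.slideMap x p r β) := by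
  refine gs.wedge_mono (gs.wedge_mono ?_ ?_) ?_
  · exact (gs.pre_mul_mul_Delta_zpow_iff _ _ _ _).2 h
  · exact (gs.pre_mul_mul_Delta_zpow_iff _ _ _ _).2 h
  · simpa using (gs.pre_mul_Delta_zpow_iff 1 _ _).2 h

theorem slideMap_Delta_zpow (gs : GarsideStructure G) (x : G) (q : ℤ) :
    gs.slideMap x (gs.ginf x) (gs.gsup x) (gs.Δ ^ q) = gs.pp x * gs.Δ ^ q := by
  have h1 : gs.Δ ^ q * gs.Δ = gs.Δ * gs.Δ ^ q := (zpow_add_one gs.Δ q).symm.trans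
    (zpow_one_add gs.Δ q ▸ by rw [add_comm])
  simp only [pp, slideMap, wedge_mul_Delta_zpow, mul_assoc, h1, ← zpow_add, add_comm q]

theorem ginf_le_ginf_sl (gs : GarsideStructure G) (hΔ : gs.Δ ≠ 1) (x : G) :
    gs.ginf x ≤ gs.ginf (gs.sl x) := by
  set p := gs.ginf x with hp
  have h1 : gs.pre 1 (gs.pp x) := by
    simp only [pp, pre_wedge_iff]
    refine ⟨⟨?_, ?_⟩, by simpa [pre] using gs.Δ_mem⟩
    · have := (gs.Delta_zpow_pre_iff hΔ x _).2 le_rfl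
      rw [← gs.pre_mul_Delta_zpow_iff (-gs.ginf x)] at this
      simpa using this
    · have := (gs.pre_Delta_zpow_iff hΔ x _).2 le_rfl
      rw [← gs.pre_mul_left_iff x⁻¹] at this
      simpa using this
  have h2 : gs.pre (gs.pp x * gs.Δ ^ p) x := by
    have : gs.pre (gs.pp x) (x * gs.Δ ^ (-p)) :=
      gs.pre_trans_s13 (gs.wedge_le_left _ _) (gs.wedge_le_left _ _)
    rw [← gs.pre_mul_Delta_zpow_iff p] at this
    simpa using this
  rw [← gs.Delta_zpow_pre_iff hΔ, sl, ← gs.pre_mul_left_iff (gs.pp x)]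
  refine gs.pre_trans_s13 h2 ?_
  rw [← gs.pre_mul_left_iff x] at h1
  simpa [mul_assoc] using h1

theorem iterate_sl_ginf (gs : GarsideStructure G) (hΔ : gs.Δ ≠ 1) {y : G} {m : ℕ} (hm : 1 ≤ m)
    (hy : gs.sl^[m] y = y) (n : ℕ) : gs.ginf (gs.sl^[n] y) = gs.ginf y := by
  have mono : ∀ k z, gs.ginf z ≤ gs.ginf (gs.sl^[k] z) := by
    intro k z
    induction k with
    | zero => rfl
    | succ k ih =>
      rw [Function.iterate_succ_apply']
      exact ih.trans (gs.ginf_le_ginf_sl hΔ _)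
  refine le_antisymm ?_ (mono n y)
  have hper : gs.sl^[n * m] y = y := by
    rw [mul_comm, Function.iterate_mul]
    exact Function.iterate_fixed hy n
  have h := mono (n * m - n) (gs.sl^[n] y)
  rwa [← Function.iterate_add_apply, Nat.sub_add_cancel (Nat.le_mul_of_pos_right n hm), hper] at h

theorem iterate_sl_gsup (gs : GarsideStructure G) (hΔ : gs.Δ ≠ 1) {y : G} {m : ℕ} (hm : 1 ≤ m)
    (hy : gs.sl^[m] y = y) (n : ℕ) : gs.gsup (gs.sl^[n] y) = gs.gsup y := by
  have h := gs.iterate_sl_ginf hΔ (y := y⁻¹) hm (by rw [gs.iterate_sl_inv hΔ, hy]) n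
  rwa [gs.iterate_sl_inv hΔ, gs.ginf_inv hΔ, gs.ginf_inv hΔ, neg_inj] at h

theorem conj_iterate_slideMap (gs : GarsideStructure G) (hΔ : gs.Δ ≠ 1) {y : G} {m : ℕ}
    (hm : 1 ≤ m) (hy : gs.sl^[m] y = y) (n : ℕ) :
    ((gs.slideMap y (gs.ginf y) (gs.gsup y))^[n] 1)⁻¹ * y *
      (gs.slideMap y (gs.ginf y) (gs.gsup y))^[n] 1 = gs.sl^[n] y := by
  induction n with
  | zero => simp
  | succ n ih =>
    have h := gs.mul_pp_conj y ((gs.slideMap y (gs.ginf y) (gs.gsup y))^[n] 1)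
    rw [ih, gs.iterate_sl_ginf hΔ hm hy, gs.iterate_sl_gsup hΔ hm hy] at h
    rw [Function.iterate_succ_apply', Function.iterate_succ_apply', ← h]
    have conj_mul : ∀ g z w : G, g⁻¹ * y * g = z → (g * w)⁻¹ * y * (g * w) = w⁻¹ * z * w := by
      rintro g _ w rfl
      group
    exact conj_mul _ _ _ ih

/-! ### Elements of sliding circuits have extremal infimum and supremum -/

/-- `α ↦ α ∧ (x α Δ^{-k})`; its fixed points are the `α` with `Δ^k ⪯ x^α`. -/
def infMap (gs : GarsideStructure G) (x : G) (k : ℤ) (α : G) : G :=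
  gs.wedge α (x * α * gs.Δ ^ (-k))

/-- `α ↦ (α Δ) ∧ (x⁻¹ α Δ^r)`. -/
def supMap (gs : GarsideStructure G) (x : G) (r : ℤ) (α : G) : G :=
  gs.wedge (α * gs.Δ) (x⁻¹ * α * gs.Δ ^ r)

theorem Delta_zpow_pre_conj_iff (gs : GarsideStructure G) (x α : G) (k : ℤ) :
    gs.pre (gs.Δ ^ k) (α⁻¹ * x * α) ↔ gs.pre α (x * α * gs.Δ ^ (-k)) := by
  rw [← gs.pre_mul_left_iff α, ← gs.pre_mul_Delta_zpow_iff (-k) (α * gs.Δ ^ k)]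
  simp [mul_assoc]

theorem Delta_zpow_pre_conj_mul_iff (gs : GarsideStructure G) (x α : G) (k q : ℤ) :
    gs.pre (gs.Δ ^ k) ((α * gs.Δ ^ q)⁻¹ * x * (α * gs.Δ ^ q)) ↔
      gs.pre (gs.Δ ^ k) (α⁻¹ * x * α) := by
  rw [Delta_zpow_pre_conj_iff, Delta_zpow_pre_conj_iff, ← gs.pre_mul_Delta_zpow_iff q α,
    mul_assoc, mul_assoc α, ← zpow_add, add_comm q, zpow_add]
  simp only [mul_assoc]

/-- A class containing an element above `Δ^k` has such an element conjugated by some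
`α ⪯ 1`. -/
theorem exists_pre_one_of_conj (gs : GarsideStructure G) {x α : G} {k : ℤ}
    (h : gs.pre (gs.Δ ^ k) (α⁻¹ * x * α)) :
    ∃ β, gs.pre β 1 ∧ gs.pre β (x * β * gs.Δ ^ (-k)) := by
  obtain ⟨q, hq, -⟩ := gs.exists_pre_Delta_zpow α
  refine ⟨α * gs.Δ ^ (-q), ?_, ?_⟩
  · rw [← gs.pre_mul_Delta_zpow_iff (-q)] at hq
    simpa using hq
  · rwa [← Delta_zpow_pre_conj_iff, Delta_zpow_pre_conj_mul_iff]

theorem eq_Delta_zpow_of_pre_of_pre_conj (gs : GarsideStructure G) {x α : G} {k : ℤ}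
    (hx : gs.pre x (gs.Δ ^ k)) (h : gs.pre (gs.Δ ^ k) (α⁻¹ * x * α)) : x = gs.Δ ^ k := by
  obtain ⟨β, hβ1, hβ⟩ := gs.exists_pre_one_of_conj h
  set Φ : G → G := fun g => x * g * gs.Δ ^ (-k) with hΦ
  have hmono : ∀ n a b, gs.pre (Φ^[n] a) (Φ^[n] b) ↔ gs.pre a b := by
    intro n a b
    induction n with
    | zero => rfl
    | succ n ih =>
      rw [Function.iterate_succ_apply', Function.iterate_succ_apply', ← ih]
      exact gs.pre_mul_mul_Delta_zpow_iff _ _ _ _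
  have hle : gs.pre (Φ 1) 1 := by
    rw [← gs.pre_mul_Delta_zpow_iff k]
    simpa [hΦ] using hx
  have hβn : ∀ n, gs.pre β (Φ^[n] β) := by
    intro n
    induction n with
    | zero => exact gs.pre_refl β
    | succ n ih =>
      rw [Function.iterate_succ_apply]
      exact gs.pre_trans_s13 ih ((hmono n _ _).2 hβ)
  obtain ⟨m, hm⟩ := gs.exists_eq_of_descending (fun n => Φ^[n] 1) β
    (fun n => by rw [Function.iterate_succ_apply]; exact (hmono n _ _).2 hle)
    (fun n => gs.pre_trans_s13 (hβn n) ((hmono n _ _).2 hβ1))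
  rw [Function.iterate_succ_apply] at hm
  have h1 : gs.pre 1 (Φ 1) := by
    rw [← hmono m, hm]; exact gs.pre_refl _
  have h2 := gs.pre_antisymm hle h1
  simpa [hΦ, mul_inv_eq_one] using h2

theorem infMap_comp_supMap (gs : GarsideStructure G) (x : G) {p r : ℤ} (hr : p + 2 ≤ r) :
    gs.infMap x (p + 1) ∘ gs.supMap x r = gs.slideMap x p r := by
  funext α
  refine gs.eq_of_forall_pre_iff fun c => ?_
  have e1 : x * (α * gs.Δ) * gs.Δ ^ (-(p + 1)) = x * α * gs.Δ ^ (-p) := by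
    rw [show -p = 1 + -(p + 1) by ring, zpow_one_add]; simp only [mul_assoc]
  have e2 : x * (x⁻¹ * α * gs.Δ ^ r) * gs.Δ ^ (-(p + 1)) = α * gs.Δ ^ (r - p - 1) := by
    rw [show r - p - 1 = r + -(p + 1) by ring, zpow_add]; simp [mul_assoc]
  have e3 : gs.pre (α * gs.Δ) (α * gs.Δ ^ (r - p - 1)) := by
    simpa using gs.pre_mul_Delta_zpow α (show (1 : ℤ) ≤ r - p - 1 by omega)
  simp only [Function.comp, infMap, supMap, slideMap, mul_wedge, wedge_mul_Delta_zpow, e1, e2,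
    pre_wedge_iff]
  constructor
  · rintro ⟨⟨h1, h2⟩, h3, -⟩
    exact ⟨⟨h3, h2⟩, h1⟩
  · rintro ⟨⟨h3, h2⟩, h1⟩
    exact ⟨⟨h1, h2⟩, h3, gs.pre_trans_s13 h1 e3⟩

theorem infMap_commute_supMap (gs : GarsideStructure G) (x : G) (k r : ℤ) :
    Function.Commute (gs.infMap x k) (gs.supMap x r) := by
  intro α
  refine gs.eq_of_forall_pre_iff fun c => ?_
  have e1 : x * (α * gs.Δ) * gs.Δ ^ (-k) = x * α * gs.Δ ^ (-k) * gs.Δ := by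
    simp only [mul_assoc, ← zpow_one_add, ← zpow_add_one, add_comm]
  have e2 : x * (x⁻¹ * α * gs.Δ ^ r) * gs.Δ ^ (-k) =
      x⁻¹ * (x * α * gs.Δ ^ (-k)) * gs.Δ ^ r := by
    simp only [mul_assoc, ← zpow_add, add_comm, mul_inv_cancel_left, inv_mul_cancel_left]
  have e3 : ∀ a b, gs.wedge a b * gs.Δ = gs.wedge (a * gs.Δ) (b * gs.Δ) := by
    simpa using gs.wedge_mul_Delta_zpow 1
  simp only [infMap, supMap, mul_wedge, wedge_mul_Delta_zpow, e3, pre_wedge_iff, e1, e2]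
  tauto

theorem infMap_eq_self_iff (gs : GarsideStructure G) (x α : G) (k : ℤ) :
    gs.infMap x k α = α ↔ gs.pre (gs.Δ ^ k) (α⁻¹ * x * α) := by
  rw [Delta_zpow_pre_conj_iff]
  refine ⟨fun h => ?_, gs.wedge_eq_left⟩
  have h' := gs.wedge_le_right α (x * α * gs.Δ ^ (-k))
  rwa [show gs.wedge α (x * α * gs.Δ ^ (-k)) = α from h] at h'

theorem ginf_conj_le_of_iterate_sl (gs : GarsideStructure G) (hΔ : gs.Δ ≠ 1) {y : G} {m : ℕ}
    (hm : 1 ≤ m) (hy : gs.sl^[m] y = y) (α : G) : gs.ginf (α⁻¹ * y * α) ≤ gs.ginf y := by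
  by_contra! hlt
  set p := gs.ginf y with hp
  have hα : gs.pre (gs.Δ ^ (p + 1)) (α⁻¹ * y * α) := (gs.Delta_zpow_pre_iff hΔ _ _).2 hlt
  have hnot : ¬ gs.pre (gs.Δ ^ (p + 1)) y := fun h => by
    have := (gs.Delta_zpow_pre_iff hΔ _ _).1 h
    omega
  rcases le_or_gt (gs.gsup y) (p + 1) with hr | hr
  · have h := gs.eq_Delta_zpow_of_pre_of_pre_conj ((gs.pre_Delta_zpow_iff hΔ _ _).2 hr) hα
    exact hnot (h ▸ gs.pre_refl _)
  · obtain ⟨β, hβ1, hβ⟩ := gs.exists_pre_one_of_conj hα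
    obtain ⟨n, hn⟩ := gs.exists_eq_of_descending (fun n => (gs.infMap y (p + 1))^[n] 1) β
      (fun n => by rw [Function.iterate_succ_apply']; exact gs.wedge_le_left _ _)
      (fun n => by
        induction n with
        | zero => exact hβ1
        | succ n ih =>
          rw [Function.iterate_succ_apply']
          exact gs.le_wedge _ _ _ ih
            (gs.pre_trans_s13 hβ ((gs.pre_mul_mul_Delta_zpow_iff _ _ _ _).2 ih)))
    rw [Function.iterate_succ_apply'] at hn
    have hcomm := gs.infMap_commute_supMap y (p + 1) (gs.gsup y)
    have hfix : gs.infMap y (p + 1) ((gs.slideMap y p (gs.gsup y))^[n] 1) =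
        (gs.slideMap y p (gs.gsup y))^[n] 1 := by
      rw [← gs.infMap_comp_supMap y (by omega), hcomm.comp_eq, hcomm.symm.comp_iterate,
        Function.comp_apply, hcomm.iterate_right n, hn]
    rw [infMap_eq_self_iff, gs.conj_iterate_slideMap hΔ hm hy, gs.Delta_zpow_pre_iff hΔ,
      gs.iterate_sl_ginf hΔ hm hy] at hfix
    omega

theorem ginf_eq_of_iterate_sl (gs : GarsideStructure G) (hΔ : gs.Δ ≠ 1) {y α : G} {m n : ℕ}
    (hm : 1 ≤ m) (hy : gs.sl^[m] y = y) (hn : 1 ≤ n)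
    (hα : gs.sl^[n] (α⁻¹ * y * α) = α⁻¹ * y * α) : gs.ginf (α⁻¹ * y * α) = gs.ginf y := by
  refine le_antisymm (gs.ginf_conj_le_of_iterate_sl hΔ hm hy α) ?_
  have h := gs.ginf_conj_le_of_iterate_sl hΔ hn hα α⁻¹
  rwa [show α⁻¹⁻¹ * (α⁻¹ * y * α) * α⁻¹ = y by group] at h

theorem gsup_eq_of_iterate_sl (gs : GarsideStructure G) (hΔ : gs.Δ ≠ 1) {y α : G} {m n : ℕ}
    (hm : 1 ≤ m) (hy : gs.sl^[m] y = y) (hn : 1 ≤ n)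
    (hα : gs.sl^[n] (α⁻¹ * y * α) = α⁻¹ * y * α) : gs.gsup (α⁻¹ * y * α) = gs.gsup y := by
  have e : α⁻¹ * y⁻¹ * α = (α⁻¹ * y * α)⁻¹ := by group
  have h := gs.ginf_eq_of_iterate_sl hΔ (y := y⁻¹) (α := α) hm
    (by rw [gs.iterate_sl_inv hΔ, hy]) hn (by rw [e, gs.iterate_sl_inv hΔ, hα])
  rwa [e, gs.ginf_inv hΔ, gs.ginf_inv hΔ, neg_inj] at h

/-! ### Iterated transport -/

theorem conj_transportIter (gs : GarsideStructure G) (y α : G) (n : ℕ) :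
    (gs.transportIter y α n)⁻¹ * gs.sl^[n] y * gs.transportIter y α n =
      gs.sl^[n] (α⁻¹ * y * α) := by
  induction n with
  | zero => rfl
  | succ n ih =>
    rw [Function.iterate_succ_apply', Function.iterate_succ_apply', ← ih]
    simp [transportIter, transport, sl, mul_assoc]

theorem transportIter_succ (gs : GarsideStructure G) (y α : G) (n : ℕ) :
    gs.transportIter y α (n + 1) = (gs.pp (gs.sl^[n] y))⁻¹ *
      (gs.transportIter y α n * gs.pp (gs.sl^[n] (α⁻¹ * y * α))) := by
  rw [← conj_transportIter, transportIter, transport, mul_assoc]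

theorem transportIter_add (gs : GarsideStructure G) (y α : G) (m n : ℕ) :
    gs.transportIter y α (m + n) =
      gs.transportIter (gs.sl^[m] y) (gs.transportIter y α m) n := by
  induction n with
  | zero => rfl
  | succ n ih =>
    rw [← add_assoc, transportIter, transportIter, ih, ← Function.iterate_add_apply, add_comm m]

theorem transportIter_injective (gs : GarsideStructure G) {y α β : G}
    (hc : α⁻¹ * y * α = β⁻¹ * y * β) {n : ℕ}
    (h : gs.transportIter y α n = gs.transportIter y β n) : α = β := by
  induction n with
  | zero => exact h
  | succ n ih =>
    rw [transportIter_succ, transportIter_succ, hc, mul_left_cancel_iff,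
      mul_right_cancel_iff] at h
    exact ih h

theorem transportIter_succ_eq_slideMap (gs : GarsideStructure G) (hΔ : gs.Δ ≠ 1) {y α : G}
    {m k : ℕ} (hm : 1 ≤ m) (hy : gs.sl^[m] y = y) (hk : 1 ≤ k)
    (hα : gs.sl^[k] (α⁻¹ * y * α) = α⁻¹ * y * α) (n : ℕ) :
    gs.transportIter y α (n + 1) = (gs.pp (gs.sl^[n] y))⁻¹ *
      gs.slideMap (gs.sl^[n] y) (gs.ginf y) (gs.gsup y) (gs.transportIter y α n) := by
  have h := gs.mul_pp_conj (gs.sl^[n] y) (gs.transportIter y α n)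
  rw [conj_transportIter, gs.iterate_sl_ginf hΔ hk hα, gs.iterate_sl_gsup hΔ hk hα,
    gs.ginf_eq_of_iterate_sl hΔ hm hy hk hα, gs.gsup_eq_of_iterate_sl hΔ hm hy hk hα] at h
  rw [transportIter_succ, h]

theorem transportIter_mono (gs : GarsideStructure G) (hΔ : gs.Δ ≠ 1) {y α β : G}
    {m k l : ℕ} (hm : 1 ≤ m) (hy : gs.sl^[m] y = y) (hk : 1 ≤ k)
    (hα : gs.sl^[k] (α⁻¹ * y * α) = α⁻¹ * y * α) (hl : 1 ≤ l)
    (hβ : gs.sl^[l] (β⁻¹ * y * β) = β⁻¹ * y * β) (h : gs.pre α β) (n : ℕ) :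
    gs.pre (gs.transportIter y α n) (gs.transportIter y β n) := by
  induction n with
  | zero => exact h
  | succ n ih =>
    rw [gs.transportIter_succ_eq_slideMap hΔ hm hy hk hα,
      gs.transportIter_succ_eq_slideMap hΔ hm hy hl hβ, pre_mul_left_iff]
    exact gs.slideMap_mono _ _ _ ih

theorem transportIter_pre_Delta_zpow (gs : GarsideStructure G) (hΔ : gs.Δ ≠ 1) {y α : G}
    {m k : ℕ} (hm : 1 ≤ m) (hy : gs.sl^[m] y = y) (hk : 1 ≤ k)
    (hα : gs.sl^[k] (α⁻¹ * y * α) = α⁻¹ * y * α) {q : ℤ} (h : gs.pre α (gs.Δ ^ q)) (n : ℕ) :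
    gs.pre (gs.transportIter y α n) (gs.Δ ^ q) := by
  induction n with
  | zero => exact h
  | succ n ih =>
    have h1 := gs.slideMap_mono (gs.sl^[n] y) (gs.ginf y) (gs.gsup y) ih
    have h2 := gs.slideMap_Delta_zpow (gs.sl^[n] y) q
    rw [gs.iterate_sl_ginf hΔ hm hy, gs.iterate_sl_gsup hΔ hm hy] at h2
    rw [h2] at h1
    rw [gs.transportIter_succ_eq_slideMap hΔ hm hy hk hα,
      ← gs.pre_mul_left_iff (gs.pp (gs.sl^[n] y)), mul_inv_cancel_left]
    exact h1

end GarsideStructure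

/-- If `c_s ⪯ c_s^{(iN)}` for some `i > 0`, then `c_s^{(iN)} = c_s`. -/
theorem no_proper_prefix (gs : GarsideStructure G) (x y s c : G)
    (hy : y ∈ gs.SC x)
    (N : ℕ) (hN : 0 < N) (hNy : (gs.sl)^[N] y = y)
    (hNmin : ∀ m : ℕ, 0 < m → (gs.sl)^[m] y = y → N ≤ m)
    (hc : gs.IsMinSCConj x y s c)
    (i : ℕ) (hi : 0 < i)
    (h : gs.pre c (gs.transportIter y c (i * N))) :
    gs.transportIter y c (i * N) = c := by
  by_cases hΔ : gs.Δ = 1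
  · rw [gs.eq_one_of_Delta_eq_one hΔ c, gs.eq_one_of_Delta_eq_one hΔ (gs.transportIter _ _ _)]
  obtain ⟨-, ⟨-, d, hd, hcd⟩, -⟩ := hc
  set M := i * N with hM
  have hyM : ∀ k, gs.sl^[k * M] y = y := fun k => by
    rw [hM, ← mul_assoc, mul_comm, Function.iterate_mul]
    exact Function.iterate_fixed hNy _
  set f : ℕ → G := fun k => gs.transportIter y c (k * M) with hf
  have hf0 : f 0 = c := by simp [hf, transportIter]
  have hf1 : f 1 = gs.transportIter y c M := by simp [hf]
  have hadd : ∀ j k, f (j + k) = gs.transportIter y (f j) (k * M) := fun j k => by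
    simp only [hf]
    rw [add_mul, transportIter_add, hyM]
  have hconj : ∀ k, (f k)⁻¹ * y * f k = gs.sl^[k * M] (c⁻¹ * y * c) := fun k => by
    have := gs.conj_transportIter y c (k * M)
    rwa [hyM] at this
  have hcirc : gs.sl^[d] ((f 1)⁻¹ * y * f 1) = (f 1)⁻¹ * y * f 1 := by
    rw [hconj, ← Function.iterate_add_apply, add_comm, Function.iterate_add_apply, hcd]
  have hasc : ∀ k, gs.pre (f k) (f (k + 1)) := fun k => by
    rw [add_comm, hadd]
    exact gs.transportIter_mono hΔ hN hNy hd hcd hd hcirc (hf1 ▸ h) _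
  obtain ⟨q, hq, -⟩ := gs.exists_pre_Delta_zpow c
  obtain ⟨k, hk⟩ := gs.exists_eq_of_ascending f (gs.Δ ^ q) hasc
    (fun k => gs.transportIter_pre_Delta_zpow hΔ hN hNy hd hcd hq _)
  have hconst : ∀ j, f (k + j) = f k := by
    intro j
    induction j with
    | zero => rfl
    | succ j ih => rw [← add_assoc, hadd, ih, ← hadd, hk]
  have hfd : f d = c := by
    refine gs.transportIter_injective (y := y) (n := k * M) ?_ ?_
    · rw [hconj, Function.iterate_mul]
      exact Function.iterate_fixed hcd _
    · rw [← hadd, add_comm, hconst]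
  have hmono : ∀ j, gs.pre (f 1) (f (1 + j)) := by
    intro j
    induction j with
    | zero => exact gs.pre_refl _
    | succ j ih => exact gs.pre_trans_s13 ih (hasc _)
  have hle : gs.pre (f 1) c := by
    have := hmono (d - 1)
    rwa [Nat.add_sub_cancel' hd, hfd] at this
  rw [← hf1]
  exact gs.pre_antisymm hle (hf1 ▸ h)
end
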